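/- Let m ≥ 0, α₁,…,αₘ ∈ {1,−1}, and X₀,…,Xₘ, Y₀,…,Yₘ ∈ W. Suppose that the words u = val(X₀) t^{α₁} val(X₁) ⋯ t^{αₘ} val(Xₘ) and v = val(Y₀) t^{α₁} val(Y₁) ⋯ t^{αₘ} val(Yₘ) are both reduced with respect to G₀ = ⟨K, t | t^{−1} a t = φ₁(a) (a ∈ A₁)⟩. Then u = v in G₀ if and only if X₀ t^{α₁} X₁ ⋯ t^{αₘ} Xₘ = Y₀ t^{α₁} Y₁ ⋯ t^{αₘ} Yₘ in G₁ = ⟨(F(W) * A₁ * B₁)/N(ℰ), t | t^{−1} a t = φ₁(a) (a ∈ A₁)⟩. -/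

import Mathlib

/-!
Multiple HNN-extension `G = ⟨H, t₁, …, tₙ | tᵢ⁻¹ a tᵢ = φᵢ(a) (a ∈ Aᵢ)⟩`, presented
as a `PresentedGroup` on the alphabet `H ⊕ ι`.
-/

/-- Relators of the multiple HNN-extension presentation. -/
def hnnRels {H : Type*} [Group H] {ι : Type*} (A B : ι → Subgroup H)
    (φ : ∀ i, A i ≃* B i) : Set (FreeGroup (H ⊕ ι)) :=
  {r | ∃ h₁ h₂ : H, r = FreeGroup.of (Sum.inl h₁) * FreeGroup.of (Sum.inl h₂) *
        (FreeGroup.of (Sum.inl (h₁ * h₂)))⁻¹} ∪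
  {r | ∃ (i : ι) (a : A i), r = (FreeGroup.of (Sum.inr i))⁻¹ *
        FreeGroup.of (Sum.inl (a : H)) * FreeGroup.of (Sum.inr i) *
        (FreeGroup.of (Sum.inl ((φ i a : B i) : H)))⁻¹}

/-- The multiple HNN-extension of `H`. -/
abbrev MHNN {H : Type*} [Group H] {ι : Type*} (A B : ι → Subgroup H)
    (φ : ∀ i, A i ≃* B i) :=
  PresentedGroup (hnnRels A B φ)

/-- Canonical generators: `Sum.inl h` for `h ∈ H`, `Sum.inr i` for the stable letter `tᵢ`. -/
def gen {H : Type*} [Group H] {ι : Type*} (A B : ι → Subgroup H)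
    (φ : ∀ i, A i ≃* B i) (x : H ⊕ ι) : MHNN A B φ :=
  PresentedGroup.of x

/-- The element represented by the word `u₀ t_{idx 0}^{e 0} u₁ ⋯ t_{idx (ℓ-1)}^{e (ℓ-1)} u_ℓ`. -/
def wordProd {H : Type*} [Group H] {ι : Type*} (A B : ι → Subgroup H)
    (φ : ∀ i, A i ≃* B i) (ℓ : ℕ) (u : ℕ → H) (idx : ℕ → ι) (e : ℕ → ℤ) :
    MHNN A B φ :=
  gen A B φ (Sum.inl (u 0)) *
    ((List.range ℓ).map fun k =>
      gen A B φ (Sum.inr (idx k)) ^ e k * gen A B φ (Sum.inl (u (k + 1)))).prod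

/-- `side A B i e` is `A i (e)`, i.e. `A i` if `e = 1` and `B i` if `e = -1`. -/
def side {H : Type*} [Group H] {ι : Type*} (A B : ι → Subgroup H) (i : ι) (e : ℤ) :
    Subgroup H :=
  if e = 1 then A i else B i

/-- The word is reduced: exponents are `±1`, no factor `tᵢ^{-α} w tᵢ^{α}` with `w ∈ A i (α)`. -/
def ReducedWord {H : Type*} [Group H] {ι : Type*} (A B : ι → Subgroup H)
    (ℓ : ℕ) (u : ℕ → H) (idx : ℕ → ι) (e : ℕ → ℤ) : Prop :=
  (∀ k < ℓ, e k = 1 ∨ e k = -1) ∧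
  ∀ k, k + 1 < ℓ → idx k = idx (k + 1) → e k = -e (k + 1) →
    u (k + 1) ∉ side A B (idx k) (e (k + 1))

section

variable (K : Type*) [Group K] (A₁ B₁ : Subgroup K) (W : Type*)

/-- The free product `F(W) ∗ A₁ ∗ B₁` (with `A₁` and `B₁` as abstract groups,
so that they have trivial intersection in the free product). -/
abbrev FP := Monoid.Coprod (FreeGroup W) (Monoid.Coprod A₁ B₁)

/-- The canonical embedding of the generator `Z ∈ W` into `F(W) ∗ A₁ ∗ B₁`. -/
def embZ (Z : W) : FP K A₁ B₁ W := Monoid.Coprod.inl (FreeGroup.of Z)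

/-- The canonical embedding of `A₁` into `F(W) ∗ A₁ ∗ B₁`. -/
def embA : A₁ →* FP K A₁ B₁ W := Monoid.Coprod.inr.comp Monoid.Coprod.inl

/-- The canonical embedding of `B₁` into `F(W) ∗ A₁ ∗ B₁`. -/
def embB : B₁ →* FP K A₁ B₁ W := Monoid.Coprod.inr.comp Monoid.Coprod.inr

/-- A letter from `A₁ ∪ B₁` (tagged by which of the two copies it comes from),
embedded into `F(W) ∗ A₁ ∗ B₁`. -/
def embC : A₁ ⊕ B₁ → FP K A₁ B₁ W :=
  Sum.elim (fun a => embA K A₁ B₁ W a) (fun b => embB K A₁ B₁ W b)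

/-- The underlying element of `K` of a letter from `A₁ ∪ B₁`. -/
def kval : A₁ ⊕ B₁ → K := Sum.elim Subtype.val Subtype.val

/-- The relators of `ℰ`: one relator `(Z₁ c₁)(c₂ Z₂)⁻¹` for each
`Z₁, Z₂ ∈ W`, `c₁, c₂ ∈ A₁ ∪ B₁` with `val(Z₁) c₁ = c₂ val(Z₂)` in `K`. -/
def relSet (val : W → K) : Set (FP K A₁ B₁ W) :=
  {r | ∃ (Z₁ Z₂ : W) (c₁ c₂ : A₁ ⊕ B₁),
    val Z₁ * kval K A₁ B₁ c₁ = kval K A₁ B₁ c₂ * val Z₂ ∧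
    r = embZ K A₁ B₁ W Z₁ * embC K A₁ B₁ W c₁ *
        (embC K A₁ B₁ W c₂ * embZ K A₁ B₁ W Z₂)⁻¹}

end

/-- The product `u 0 * s ^ e 0 * u 1 * ⋯ * s ^ e (m - 1) * u m` in a group. -/
def alternatingProd {M : Type*} [Group M] (u : ℕ → M) (s : M) (e : ℕ → ℤ) (m : ℕ) : M :=
  u 0 * ((List.range m).map fun k => s ^ e k * u (k + 1)).prod

section AlternatingProd

variable {M N : Type*} [Group M] [Group N]

theorem alternatingProd_zero (u : ℕ → M) (s : M) (e : ℕ → ℤ) :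
    alternatingProd u s e 0 = u 0 := by
  simp [alternatingProd]

theorem alternatingProd_succ (u : ℕ → M) (s : M) (e : ℕ → ℤ) (m : ℕ) :
    alternatingProd u s e (m + 1) =
      u 0 * s ^ e 0 * alternatingProd (fun k => u (k + 1)) s (fun k => e (k + 1)) m := by
  simp [alternatingProd, List.range_succ_eq_map, Function.comp_def, mul_assoc]

theorem map_alternatingProd (F : M →* N) (u : ℕ → M) (s : M) (e : ℕ → ℤ) (m : ℕ) :
    F (alternatingProd u s e m) = alternatingProd (fun k => F (u k)) (F s) e m := by
  simp [alternatingProd, map_list_prod, Function.comp_def]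

theorem alternatingProd_congr_exponent (u : ℕ → M) (s : M) {e e' : ℕ → ℤ} {m : ℕ}
    (h : ∀ k < m, e k = e' k) : alternatingProd u s e m = alternatingProd u s e' m := by
  unfold alternatingProd
  congr 2
  refine List.map_congr_left fun k hk => ?_
  rw [h k (List.mem_range.1 hk)]

end AlternatingProd

section MultipleHNN

variable {H : Type*} [Group H] {ι : Type*} (A B : ι → Subgroup H) (φ : ∀ i, A i ≃* B i)

/-- The canonical homomorphism from the base group to a multiple HNN-extension. -/
def baseHom : H →* MHNN A B φ :=
  MonoidHom.mk' (fun h => gen A B φ (Sum.inl h)) fun a b => by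
    have h : PresentedGroup.mk (hnnRels A B φ) _ = 1 :=
      PresentedGroup.one_of_mem (Or.inl ⟨a, b, rfl⟩)
    simp only [map_mul, map_inv] at h
    exact (mul_inv_eq_one.1 h).symm

theorem baseHom_apply (h : H) : baseHom A B φ h = gen A B φ (Sum.inl h) := rfl

theorem inv_gen_mul_baseHom_mul_gen (i : ι) (a : A i) :
    (gen A B φ (Sum.inr i))⁻¹ * baseHom A B φ a * gen A B φ (Sum.inr i) =
      baseHom A B φ (φ i a) := by
  have h : PresentedGroup.mk (hnnRels A B φ) _ = 1 :=
    PresentedGroup.one_of_mem (Or.inr ⟨i, a, rfl⟩)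
  simp only [map_mul, map_inv] at h
  exact mul_inv_eq_one.1 h

/-- The universal property of a multiple HNN-extension. -/
def liftMHNN {M : Type*} [Group M] (f : H →* M) (s : ι → M)
    (h : ∀ i (a : A i), (s i)⁻¹ * f a * s i = f (φ i a)) : MHNN A B φ →* M :=
  PresentedGroup.toGroup (f := Sum.elim f s) (by
    rintro r (⟨a, b, rfl⟩ | ⟨i, a, rfl⟩)
    · simp
    · simp [h])

theorem liftMHNN_gen {M : Type*} [Group M] (f : H →* M) (s : ι → M)
    (h : ∀ i (a : A i), (s i)⁻¹ * f a * s i = f (φ i a)) (x : H ⊕ ι) :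
    liftMHNN A B φ f s h (gen A B φ x) = Sum.elim f s x :=
  PresentedGroup.toGroup.of _

theorem wordProd_eq_alternatingProd (m : ℕ) (u : ℕ → H) (i : ι) (e : ℕ → ℤ) :
    wordProd A B φ m u (fun _ => i) e =
      alternatingProd (fun k => baseHom A B φ (u k)) (gen A B φ (Sum.inr i)) e m := rfl

end MultipleHNN

section Transfer

variable {K : Type*} [Group K] {A₁ B₁ : Subgroup K} {W : Type*}

open HNNExtension HNNExtension.NormalWord

/-- The comparison with the HNN-extension in Mathlib, whose convention is `t * a = φ a * t`. -/
def toHNNExtension (φ₁ : A₁ ≃* B₁) :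
    MHNN (fun _ : Unit => A₁) (fun _ => B₁) (fun _ => φ₁) →* HNNExtension K B₁ A₁ φ₁.symm :=
  liftMHNN _ _ _ of (fun _ => t) fun _ a => by
    simpa using (equiv_symm_eq_conj (φ := φ₁.symm) a).symm

theorem toHNNExtension_gen_inl (φ₁ : A₁ ≃* B₁) (x : K) :
    toHNNExtension φ₁ (gen _ _ _ (Sum.inl x)) = of x :=
  liftMHNN_gen _ _ _ _ _ _ _

theorem toHNNExtension_gen_inr (φ₁ : A₁ ≃* B₁) (i : Unit) :
    toHNNExtension φ₁ (gen _ _ _ (Sum.inr i)) = t :=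
  liftMHNN_gen _ _ _ _ _ _ _

/-- The reduced word with head `g` and syllables `t ^ ε k * u (k + 1)` for `k < m`. -/
def reducedWordOfFn (A B : Subgroup K) (g : K) (u : ℕ → K) (ε : ℕ → ℤˣ) (m : ℕ)
    (h : ∀ k, k + 1 < m → u (k + 1) ∈ toSubgroup A B (ε k) → ε k = ε (k + 1)) :
    HNNExtension.NormalWord.ReducedWord K A B where
  head := g
  toList := (List.range m).map fun k => (ε k, u (k + 1))
  chain := by
    rw [List.isChain_iff_getElem]
    intro k hk
    simp only [List.length_map, List.length_range] at hk
    simpa using h k hk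

theorem reducedWordOfFn_prod (A B : Subgroup K) (φ : A ≃* B) (g : K) (u : ℕ → K)
    (ε : ℕ → ℤˣ) (m : ℕ)
    (h : ∀ k, k + 1 < m → u (k + 1) ∈ toSubgroup A B (ε k) → ε k = ε (k + 1)) :
    (reducedWordOfFn A B (g * u 0) u ε m h).prod φ =
      of g * alternatingProd (fun k => of (u k)) t (fun k => (ε k : ℤ)) m := by
  simp [reducedWordOfFn, HNNExtension.NormalWord.ReducedWord.prod, alternatingProd,
    Function.comp_def, mul_assoc]

/-- If `g * u` and `v` are reduced words with the same exponents that agree in the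
HNN-extension, then the equality can be derived from the equations between single syllables
and the conjugation relations. -/
theorem alternatingProd_transfer (val : W → K) (φ₁ : A₁ ≃* B₁) {M : Type*} [Group M]
    (f : W → M) (g : A₁ ⊕ B₁ → M) (s : M) (hg : g (Sum.inl 1) = 1)
    (hE : ∀ Z₁ Z₂ c₁ c₂, val Z₁ * kval K A₁ B₁ c₁ = kval K A₁ B₁ c₂ * val Z₂ →
      f Z₁ * g c₁ = g c₂ * f Z₂)
    (hs : ∀ a, s⁻¹ * g (Sum.inl a) * s = g (Sum.inr (φ₁ a)))
    (m : ℕ) (X Y : ℕ → W) (ε : ℕ → ℤˣ) (c : A₁ ⊕ B₁)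
    (hX : ∀ k, k + 1 < m → val (X (k + 1)) ∈ toSubgroup B₁ A₁ (ε k) → ε k = ε (k + 1))
    (hY : ∀ k, k + 1 < m → val (Y (k + 1)) ∈ toSubgroup B₁ A₁ (ε k) → ε k = ε (k + 1))
    (h : alternatingProd (fun k => (of (val (X k)) : HNNExtension K B₁ A₁ φ₁.symm)) t
          (fun k => (ε k : ℤ)) m =
        of (kval K A₁ B₁ c) * alternatingProd (fun k => of (val (Y k))) t
          (fun k => (ε k : ℤ)) m) :
    alternatingProd (fun k => f (X k)) s (fun k => (ε k : ℤ)) m =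
      g c * alternatingProd (fun k => f (Y k)) s (fun k => (ε k : ℤ)) m := by
  induction m generalizing X Y ε c with
  | zero =>
    simp only [alternatingProd_zero, ← map_mul] at h ⊢
    have := hE (X 0) (Y 0) (Sum.inl 1) c (by simpa [kval] using of_injective _ h)
    simpa [hg] using this
  | succ m ih =>
    have hprod : (reducedWordOfFn B₁ A₁ (1 * val (X 0)) (fun k => val (X k)) ε (m + 1) hX).prod
          φ₁.symm =
        (reducedWordOfFn B₁ A₁ (kval K A₁ B₁ c * val (Y 0)) (fun k => val (Y k)) ε
          (m + 1) hY).prod φ₁.symm := by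
      rw [reducedWordOfFn_prod (u := fun k => val (X k)),
        reducedWordOfFn_prod (u := fun k => val (Y k)), h, map_one, one_mul]
    have hd := (HNNExtension.ReducedWord.map_fst_eq_and_of_prod_eq _ hprod).2 (ε 0)
      (by simp [reducedWordOfFn, List.range_succ_eq_map])
    simp only [reducedWordOfFn, one_mul] at hd
    rw [alternatingProd_succ, alternatingProd_succ] at h ⊢
    obtain ⟨d, hd'⟩ : ∃ d, d = (val (X 0))⁻¹ * (kval K A₁ B₁ c * val (Y 0)) := ⟨_, rfl⟩
    rw [← hd'] at hd
    have hd'' : val (X 0) * d = kval K A₁ B₁ c * val (Y 0) := by rw [hd']; group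
    have step : t ^ (ε 0 : ℤ) * alternatingProd
          (fun k => (of (val (X (k + 1))) : HNNExtension K B₁ A₁ φ₁.symm)) t
          (fun k => (ε (k + 1) : ℤ)) m =
        of d * t ^ (ε 0 : ℤ) * alternatingProd (fun k => of (val (Y (k + 1)))) t
          (fun k => (ε (k + 1) : ℤ)) m := by
      apply mul_left_cancel (a := of (val (X 0)))
      simp only [← mul_assoc, ← map_mul, hd''] at h ⊢
      exact h
    have finish : ∀ c₁ c₂ : A₁ ⊕ B₁, kval K A₁ B₁ c₁ = d →
        (of d * t ^ (ε 0 : ℤ) : HNNExtension K B₁ A₁ φ₁.symm) =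
          t ^ (ε 0 : ℤ) * of (kval K A₁ B₁ c₂) →
        g c₁ * s ^ (ε 0 : ℤ) = s ^ (ε 0 : ℤ) * g c₂ →
        f (X 0) * s ^ (ε 0 : ℤ) * alternatingProd (fun k => f (X (k + 1))) s
            (fun k => (ε (k + 1) : ℤ)) m =
          g c * (f (Y 0) * s ^ (ε 0 : ℤ) * alternatingProd (fun k => f (Y (k + 1))) s
            (fun k => (ε (k + 1) : ℤ)) m) := by
      intro c₁ c₂ h₁ h₂ h₃
      rw [h₂, mul_assoc] at step
      rw [ih (fun k => X (k + 1)) (fun k => Y (k + 1)) (fun k => ε (k + 1)) c₂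
        (fun k hk => hX (k + 1) (by lia)) (fun k hk => hY (k + 1) (by lia))
        (mul_left_cancel step)]
      simp only [← mul_assoc]
      rw [mul_assoc (f (X 0)), ← h₃, ← mul_assoc, hE (X 0) (Y 0) c₁ c (by rw [h₁, hd''])]
    rcases Int.units_eq_one_or (ε 0) with h0 | h0
    · rw [h0] at hd
      refine finish (Sum.inl ⟨d, hd⟩) (Sum.inr (φ₁ ⟨d, hd⟩)) rfl ?_ ?_
      · simpa [h0, kval] using of_mul_t (φ := φ₁.symm) ⟨d, hd⟩
      · simp [h0, ← hs, mul_assoc]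
    · rw [h0, neg_neg] at hd
      refine finish (Sum.inr ⟨d, hd⟩) (Sum.inl (φ₁.symm ⟨d, hd⟩)) rfl ?_ ?_
      · simpa [h0, kval] using of_mul_inv_t (φ := φ₁.symm) ⟨d, hd⟩
      · have := hs (φ₁.symm ⟨d, hd⟩)
        rw [φ₁.apply_symm_apply] at this
        simp [h0, ← this, mul_assoc]

/-- Comparison of the two HNN-extensions, for any group `Q` in between the presented quotient of
`F(W) ∗ A₁ ∗ B₁` and the base group `K`. -/
theorem wordProd_eq_iff_of_factorization (val : W → K) (φ₁ : A₁ ≃* B₁) {Q : Type*} [Group Q]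
    (π : FP K A₁ B₁ W →* Q) (hπ : ∀ r ∈ relSet K A₁ B₁ W val, π r = 1) (p : Q →* K)
    (hp : ∀ x, p (π x) = Monoid.Coprod.lift (FreeGroup.lift val)
      (Monoid.Coprod.lift A₁.subtype B₁.subtype) x)
    (m : ℕ) (X Y : ℕ → W) (e : ℕ → ℤ) (he : ∀ k < m, e k = 1 ∨ e k = -1)
    (hX : ∀ k, k + 1 < m →
      (e k = -1 → e (k + 1) = 1 → val (X (k + 1)) ∉ A₁) ∧
      (e k = 1 → e (k + 1) = -1 → val (X (k + 1)) ∉ B₁))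
    (hY : ∀ k, k + 1 < m →
      (e k = -1 → e (k + 1) = 1 → val (Y (k + 1)) ∉ A₁) ∧
      (e k = 1 → e (k + 1) = -1 → val (Y (k + 1)) ∉ B₁))
    (φ' : Subgroup.map π (embA K A₁ B₁ W).range ≃* Subgroup.map π (embB K A₁ B₁ W).range)
    (hφ' : ∀ a : A₁,
      (φ' ⟨π (embA K A₁ B₁ W a),
        Subgroup.mem_map_of_mem _ (MonoidHom.mem_range.mpr ⟨a, rfl⟩)⟩ : Q) =
        π (embB K A₁ B₁ W (φ₁ a))) :
    (wordProd (fun _ : Unit => A₁) (fun _ => B₁) (fun _ => φ₁) m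
        (fun k => val (X k)) (fun _ => ()) e =
      wordProd (fun _ : Unit => A₁) (fun _ => B₁) (fun _ => φ₁) m
        (fun k => val (Y k)) (fun _ => ()) e) ↔
    (wordProd _ _ (fun _ : Unit => φ') m (fun k => π (embZ K A₁ B₁ W (X k)))
        (fun _ => ()) e =
      wordProd _ _ (fun _ : Unit => φ') m (fun k => π (embZ K A₁ B₁ W (Y k)))
        (fun _ => ()) e) := by
  simp only [wordProd_eq_alternatingProd]
  constructor
  · intro h
    let ε : ℕ → ℤˣ := fun k => if e k = 1 then 1 else -1
    have hε : ∀ k < m, e k = (ε k : ℤ) := by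
      intro k hk
      rcases he k hk with h1 | h1 <;> simp [ε, h1]
    have reduced : ∀ Z : ℕ → W, (∀ k, k + 1 < m →
        (e k = -1 → e (k + 1) = 1 → val (Z (k + 1)) ∉ A₁) ∧
        (e k = 1 → e (k + 1) = -1 → val (Z (k + 1)) ∉ B₁)) →
        ∀ k, k + 1 < m → val (Z (k + 1)) ∈ HNNExtension.toSubgroup B₁ A₁ (ε k) →
          ε k = ε (k + 1) := by
      intro Z hZ k hk hmem
      rcases he k (by lia) with h1 | h1 <;> rcases he (k + 1) hk with h2 | h2
      · simp [ε, h1, h2]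
      · exact absurd (by simpa [ε, h1] using hmem) ((hZ k hk).2 h1 h2)
      · exact absurd (by simpa [ε, h1] using hmem) ((hZ k hk).1 h1 h2)
      · simp [ε, h1, h2]
    have hF := congrArg (toHNNExtension φ₁) h
    simp only [map_alternatingProd, baseHom_apply, toHNNExtension_gen_inl,
      toHNNExtension_gen_inr] at hF
    rw [alternatingProd_congr_exponent _ _ hε, alternatingProd_congr_exponent _ _ hε] at hF ⊢
    have key := alternatingProd_transfer val φ₁
      (fun Z => baseHom _ _ (fun _ : Unit => φ') (π (embZ K A₁ B₁ W Z)))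
      (fun c => baseHom _ _ (fun _ : Unit => φ') (π (embC K A₁ B₁ W c)))
      (gen _ _ (fun _ : Unit => φ') (Sum.inr ()))
      (by simp [embC])
      (by
        intro Z₁ Z₂ c₁ c₂ hc
        simp only [← map_mul]
        congr 1
        have : π (embZ K A₁ B₁ W Z₁ * embC K A₁ B₁ W c₁ *
            (embC K A₁ B₁ W c₂ * embZ K A₁ B₁ W Z₂)⁻¹) = 1 :=
          hπ _ ⟨Z₁, Z₂, c₁, c₂, hc, rfl⟩
        rwa [map_mul, map_inv, mul_inv_eq_one] at this)
      (by
        intro a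
        have := inv_gen_mul_baseHom_mul_gen _ _ (fun _ : Unit => φ') ()
          ⟨π (embA K A₁ B₁ W a),
            Subgroup.mem_map_of_mem _ (MonoidHom.mem_range.mpr ⟨a, rfl⟩)⟩
        rw [hφ'] at this
        exact this)
      m X Y ε (Sum.inl 1) (reduced X hX) (reduced Y hY) (by simpa [kval] using hF)
    simpa [embC] using key
  · intro h
    have hF := congrArg (liftMHNN _ _ (fun _ : Unit => φ')
      ((baseHom (fun _ : Unit => A₁) (fun _ => B₁) (fun _ => φ₁)).comp p)
      (fun i => gen _ _ _ (Sum.inr i)) (by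
        rintro i ⟨_, _, ⟨a, rfl⟩, rfl⟩
        rw [hφ']
        simpa [hp, embA, embB] using
          inv_gen_mul_baseHom_mul_gen (fun _ : Unit => A₁) (fun _ => B₁) (fun _ => φ₁) i a)) h
    simp only [map_alternatingProd, baseHom_apply, liftMHNN_gen, Sum.elim_inl,
      Sum.elim_inr] at hF
    simpa [hp, embZ, baseHom_apply] using hF

end Transfer

section

variable (K : Type*) [Group K] (A₁ B₁ : Subgroup K) (W : Type*)

/-- Let `u = val(X₀) t^{α₁} ⋯ t^{αₘ} val(Xₘ)` and
`v = val(Y₀) t^{α₁} ⋯ t^{αₘ} val(Yₘ)` be reduced with respect to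
`G₀ = ⟨K, t | t⁻¹ a t = φ₁(a) (a ∈ A₁)⟩`. Then `u = v` in `G₀` iff
`X₀ t^{α₁} X₁ ⋯ t^{αₘ} Xₘ = Y₀ t^{α₁} Y₁ ⋯ t^{αₘ} Yₘ` in the HNN-extension
`G₁ = ⟨(F(W) ∗ A₁ ∗ B₁)/N(ℰ), t | t⁻¹ a t = φ₁(a) (a ∈ A₁)⟩`, where the associated
subgroups of `G₁` are the images of `A₁` and `B₁` in the quotient and the associated
isomorphism `φ'` is the one induced by `φ₁`. -/
theorem eq_in_G₀_iff_eq_in_G₁ (val : W → K) (φ₁ : A₁ ≃* B₁)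
    (m : ℕ) (X Y : ℕ → W) (e : ℕ → ℤ) (he : ∀ k < m, e k = 1 ∨ e k = -1)
    (hX : ∀ k, k + 1 < m →
      (e k = -1 → e (k + 1) = 1 → val (X (k + 1)) ∉ A₁) ∧
      (e k = 1 → e (k + 1) = -1 → val (X (k + 1)) ∉ B₁))
    (hY : ∀ k, k + 1 < m →
      (e k = -1 → e (k + 1) = 1 → val (Y (k + 1)) ∉ A₁) ∧
      (e k = 1 → e (k + 1) = -1 → val (Y (k + 1)) ∉ B₁))
    (φ' : Subgroup.map
            (QuotientGroup.mk' (Subgroup.normalClosure (relSet K A₁ B₁ W val)))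
            (embA K A₁ B₁ W).range ≃*
          Subgroup.map
            (QuotientGroup.mk' (Subgroup.normalClosure (relSet K A₁ B₁ W val)))
            (embB K A₁ B₁ W).range)
    (hφ' : ∀ a : A₁,
      ((φ' ⟨(QuotientGroup.mk' (Subgroup.normalClosure (relSet K A₁ B₁ W val)))
              (embA K A₁ B₁ W a),
            Subgroup.mem_map_of_mem _ (MonoidHom.mem_range.mpr ⟨a, rfl⟩)⟩ :
          Subgroup.map
            (QuotientGroup.mk' (Subgroup.normalClosure (relSet K A₁ B₁ W val)))
            (embB K A₁ B₁ W).range) : 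
          FP K A₁ B₁ W ⧸ Subgroup.normalClosure (relSet K A₁ B₁ W val)) =
        (QuotientGroup.mk' (Subgroup.normalClosure (relSet K A₁ B₁ W val)))
          (embB K A₁ B₁ W (φ₁ a))) :
    (wordProd (fun _ : Unit => A₁) (fun _ => B₁) (fun _ => φ₁) m
        (fun k => val (X k)) (fun _ => ()) e =
      wordProd (fun _ : Unit => A₁) (fun _ => B₁) (fun _ => φ₁) m
        (fun k => val (Y k)) (fun _ => ()) e) ↔
    (wordProd (fun _ : Unit =>
          Subgroup.map
            (QuotientGroup.mk' (Subgroup.normalClosure (relSet K A₁ B₁ W val)))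
            (embA K A₁ B₁ W).range)
        (fun _ =>
          Subgroup.map
            (QuotientGroup.mk' (Subgroup.normalClosure (relSet K A₁ B₁ W val)))
            (embB K A₁ B₁ W).range)
        (fun _ => φ') m
        (fun k => (QuotientGroup.mk' (Subgroup.normalClosure (relSet K A₁ B₁ W val)))
          (embZ K A₁ B₁ W (X k)))
        (fun _ => ()) e =
      wordProd (fun _ : Unit =>
          Subgroup.map
            (QuotientGroup.mk' (Subgroup.normalClosure (relSet K A₁ B₁ W val)))
            (embA K A₁ B₁ W).range)
        (fun _ =>
          Subgroup.map
            (QuotientGroup.mk' (Subgroup.normalClosure (relSet K A₁ B₁ W val)))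
            (embB K A₁ B₁ W).range)
        (fun _ => φ') m
        (fun k => (QuotientGroup.mk' (Subgroup.normalClosure (relSet K A₁ B₁ W val)))
          (embZ K A₁ B₁ W (Y k)))
        (fun _ => ()) e) := by
  have hval : Subgroup.normalClosure (relSet K A₁ B₁ W val) ≤
      (Monoid.Coprod.lift (FreeGroup.lift val)
        (Monoid.Coprod.lift A₁.subtype B₁.subtype)).ker := by
    refine Subgroup.normalClosure_le_normal ?_
    rintro _ ⟨Z₁, Z₂, c₁, c₂, hc, rfl⟩
    rw [SetLike.mem_coe, MonoidHom.mem_ker, map_mul, map_inv, mul_inv_eq_one]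
    cases c₁ <;> cases c₂ <;> simpa [embZ, embC, embA, embB, kval] using hc
  exact wordProd_eq_iff_of_factorization val φ₁ _
    (fun r hr => (QuotientGroup.eq_one_iff r).2 (Subgroup.subset_normalClosure hr))
    (QuotientGroup.lift _ _ hval) (fun _ => rfl) m X Y e he hX hY φ' hφ'

end
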